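/- arXiv:2406.18970 — 5 statements merged into one kernel-verified Lean document; each statement's English description precedes it below -/
import Mathlib

section
/- A degree 2n integer polynomial f is reciprocal if and only if the Cayley-transformed polynomial \tilde{f}(x) = (1+x)^{2n} f((1-x)/(1+x)) is even, i.e., \tilde{f}(x) = \tilde{g}(x^2) for some polynomial \tilde{g}. -/
open Polynomial

/-- The polynomials `(1 - X) ^ i * (1 + X) ^ (N - i)`, `i ≤ N`, are linearly independent. -/
theorem coeff_eq_zero_of_cayley_sum_eq_zero (N : ℕ) (c : ℕ → ℤ)
    (h : ∑ i ∈ Finset.range (N + 1),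
      C (c i) * (1 - X : ℤ[X]) ^ i * (1 + X) ^ (N - i) = 0) :
    ∀ i ≤ N, c i = 0 := by
  induction N with
  | zero =>
    intro i hi
    obtain rfl : i = 0 := by omega
    simpa using h
  | succ N ih =>
    have split : ∑ i ∈ Finset.range (N + 1),
        C (c i) * (1 - X : ℤ[X]) ^ i * (1 + X) ^ (N + 1 - i) =
        (1 + X) * ∑ i ∈ Finset.range (N + 1),
          C (c i) * (1 - X : ℤ[X]) ^ i * (1 + X) ^ (N - i) := by
      rw [Finset.mul_sum]
      refine Finset.sum_congr rfl fun i hi => ?_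
      rw [Nat.sub_add_comm (Finset.mem_range_succ_iff.mp hi), pow_succ]
      ring
    rw [Finset.sum_range_succ, split] at h
    have htop : c (N + 1) = 0 := by
      simpa using congrArg (eval (-1)) h
    have hne : (1 + X : ℤ[X]) ≠ 0 := by
      intro h0
      simpa using congrArg (eval 0) h0
    have hrest := (mul_eq_zero.mp (by simpa [htop] using h)).resolve_left hne
    intro i hi
    rcases Nat.le_succ_iff.mp hi with hi | rfl
    · exact ih hrest i hi
    · exact htop

/-- Substituting `-X` in a Cayley transform reverses the coefficients. -/
theorem cayley_sum_comp_neg_X (N : ℕ) (c : ℕ → ℤ) :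
    (∑ i ∈ Finset.range (N + 1),
      C (c i) * (1 - X : ℤ[X]) ^ i * (1 + X) ^ (N - i)).comp (-X) =
    ∑ i ∈ Finset.range (N + 1),
      C (c (N - i)) * (1 - X : ℤ[X]) ^ i * (1 + X) ^ (N - i) := by
  rw [← Finset.sum_range_reflect, Polynomial.sum_comp]
  refine Finset.sum_congr rfl fun i hi => ?_
  have hi' : i ≤ N := Finset.mem_range_succ_iff.mp hi
  simp only [Nat.add_sub_cancel, Nat.sub_sub_self hi', mul_comp, pow_comp, C_comp, sub_comp,
    add_comp, one_comp, X_comp]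
  ring

theorem exists_eq_comp_X_sq_iff_comp_neg_X (F : ℤ[X]) :
    (∃ g : ℤ[X], F = g.comp (X ^ 2)) ↔ F.comp (-X) = F := by
  constructor
  · rintro ⟨g, rfl⟩
    simp [comp_assoc]
  · intro h
    refine ⟨contract 2 F, ?_⟩
    rw [← expand_eq_comp_X_pow]
    ext k
    rw [coeff_expand two_pos, coeff_contract two_ne_zero]
    split_ifs with hk
    · rw [Nat.div_mul_cancel hk]
    · have hodd : Odd k := by rwa [← Nat.not_even_iff_odd, even_iff_two_dvd]
      have hc := congrArg (fun p => coeff p k) h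
      rw [show (-X : ℤ[X]) = C (-1) * X by simp] at hc
      simp only [comp_C_mul_X_coeff, hodd.neg_one_pow] at hc
      omega

theorem reflect_eq_self_iff (N : ℕ) (f : ℤ[X]) :
    reflect N f = f ↔ ∀ i ≤ N, f.coeff (N - i) = f.coeff i := by
  simp only [Polynomial.ext_iff, coeff_reflect]
  refine forall_congr' fun i => ?_
  by_cases hi : i ≤ N
  · simp [hi, revAt_le hi]
  · simp [hi, revAt_eq_self_of_lt (not_le.mp hi)]

/-- A degree-`2n` integer polynomial `f` is reciprocal (`x^(2n) f(1/x) = f(x)`,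
i.e. `reflect (2n) f = f`) if and only if the Cayley-transformed polynomial
`f̃(x) = (1+x)^(2n) f((1-x)/(1+x))` is even, i.e. a polynomial in `x²`. -/
theorem reciprocal_iff_cayley_even (n : ℕ) (f : Polynomial ℤ) (hdeg : f.natDegree = 2 * n) :
    Polynomial.reflect (2 * n) f = f ↔
      ∃ g : Polynomial ℤ,
        (∑ i ∈ Finset.range (2 * n + 1),
            Polynomial.C (f.coeff i) * (1 - Polynomial.X) ^ i * (1 + Polynomial.X) ^ (2 * n - i))
          = g.comp (Polynomial.X ^ 2) := by
  rw [exists_eq_comp_X_sq_iff_comp_neg_X, cayley_sum_comp_neg_X, reflect_eq_self_iff]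
  constructor
  · intro h
    refine Finset.sum_congr rfl fun i hi => ?_
    rw [h i (Finset.mem_range_succ_iff.mp hi)]
  · intro h i hi
    refine sub_eq_zero.mp (coeff_eq_zero_of_cayley_sum_eq_zero (2 * n)
      (fun i => f.coeff (2 * n - i) - f.coeff i) ?_ i hi)
    simpa only [C_sub, sub_mul, Finset.sum_sub_distrib] using sub_eq_zero.mpr h
end

section
/- Let X ⋊ S be a semidirect product of groups with X abelian. Then every maximal subgroup of X ⋊ S is of one of two types: (a) X ⋊ S' for some maximal subgroup S' < S; or (b) a subgroup G < X ⋊ S such that the projection G → S is surjective and G ∩ X is a maximal S-invariant subgroup of X (where S acts on X by conjugation). -/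
open SemidirectProduct


namespace SemidirectProduct

variable {X S : Type*} [CommGroup X] [Group S] {φ : S →* MulAut X}

/-- When the normal factor is abelian, conjugation on it depends only on the projection of the
conjugating element. -/
theorem conj_inl_of_comm (g : X ⋊[φ] S) (x : X) :
    g * inl x * g⁻¹ = inl (φ g.right x) := by
  ext
  · simp [mul_right_comm]
  · simp

/-- A subgroup of the abelian normal factor which is stable under the action is normal. -/
theorem normal_map_inl_of_invariant {Y : Subgroup X} (hY : ∀ (s : S), ∀ x ∈ Y, φ s x ∈ Y) :
    (Y.map (inl : X →* X ⋊[φ] S)).Normal := by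
  refine ⟨?_⟩
  rintro _ ⟨y, hy, rfl⟩ g
  rw [conj_inl_of_comm]
  exact ⟨_, hY _ _ hy, rfl⟩

end SemidirectProduct

/-- **Lemma 3.1**: let `X ⋊ S` be a semidirect product with `X` abelian.  Every maximal
subgroup `G` of `X ⋊ S` is of one of two types:
(a) `X ⋊ S'` (the preimage of `S'` under the projection) for a maximal subgroup `S' < S`;
(b) the projection `G → S` is surjective and `Y = G ∩ X` is a maximal `S`-invariant
subgroup of `X`. -/
theorem maximal_subgroup_semidirect {X S : Type*} [CommGroup X] [Group S]
    (φ : S →* MulAut X) (G : Subgroup (X ⋊[φ] S)) (hG : IsCoatom G) :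
    (∃ S' : Subgroup S, IsCoatom S' ∧
        G = Subgroup.comap (SemidirectProduct.rightHom : X ⋊[φ] S →* S) S') ∨
    ((∀ s : S, ∃ g ∈ G, SemidirectProduct.rightHom g = s) ∧
      (Subgroup.comap (SemidirectProduct.inl : X →* X ⋊[φ] S) G ≠ ⊤ ∧
       (∀ (s : S) (x : X), x ∈ Subgroup.comap (SemidirectProduct.inl : X →* X ⋊[φ] S) G →
          φ s x ∈ Subgroup.comap (SemidirectProduct.inl : X →* X ⋊[φ] S) G) ∧
       (∀ Y' : Subgroup X, (∀ (s : S) (x : X), x ∈ Y' → φ s x ∈ Y') →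
          Subgroup.comap (SemidirectProduct.inl : X →* X ⋊[φ] S) G < Y' → Y' = ⊤))) := by
  by_cases hker : (rightHom : X ⋊[φ] S →* S).ker ≤ G
  · left
    have hcomap : (G.map rightHom).comap (rightHom : X ⋊[φ] S →* S) = G :=
      Subgroup.comap_map_eq_self hker
    refine ⟨G.map rightHom, ⟨fun h => hG.1 ?_, fun T hT => ?_⟩, hcomap.symm⟩
    · rw [← hcomap, h, Subgroup.comap_top]
    · have hlt := (Subgroup.comap_lt_comap_of_surjective
        (rightHom_surjective (φ := φ))).2 hT
      rw [hcomap] at hlt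
      rw [← Subgroup.map_comap_eq_self_of_surjective (rightHom_surjective (φ := φ)) T,
        hG.2 _ hlt, Subgroup.map_top_of_surjective _ rightHom_surjective]
  · right
    have hsurj : ∀ s : S, ∃ g ∈ G, (rightHom : X ⋊[φ] S →* S) g = s := by
      intro s
      have hsup : G ⊔ (rightHom : X ⋊[φ] S →* S).ker = ⊤ := hG.2 _ (left_lt_sup.2 hker)
      have hs : (inr s : X ⋊[φ] S) ∈ (G.map rightHom).comap (rightHom : X ⋊[φ] S →* S) := by
        rw [Subgroup.comap_map_eq, hsup]
        trivial
      simpa using hs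
    refine ⟨hsurj, fun h => hker ?_, fun s x hx => ?_, fun Y' hY' hlt => ?_⟩
    · rw [← range_inl_eq_ker_rightHom]
      rintro _ ⟨x, rfl⟩
      exact Subgroup.mem_comap.1 (h ▸ Subgroup.mem_top x)
    · obtain ⟨g, hg, rfl⟩ := hsurj s
      rw [Subgroup.mem_comap] at hx ⊢
      rw [rightHom_eq_right, ← conj_inl_of_comm]
      exact G.mul_mem (G.mul_mem hg hx) (G.inv_mem hg)
    · have := normal_map_inl_of_invariant hY'
      have hsup : G ⊔ Y'.map (inl : X →* X ⋊[φ] S) = ⊤ :=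
        hG.2 _ (left_lt_sup.2 fun h => hlt.not_ge (Subgroup.map_le_iff_le_comap.1 h))
      refine (Subgroup.eq_top_iff' _).2 fun x => ?_
      have hx : (inl x : X ⋊[φ] S) ∈ G ⊔ Y'.map (inl : X →* X ⋊[φ] S) := by
        rw [hsup]
        trivial
      obtain ⟨g, hg, _, ⟨y, hy, rfl⟩, hgy⟩ := Subgroup.mem_sup_of_normal_right.1 hx
      have hgx : inl (x * y⁻¹) = g := by
        rw [map_mul, map_inv, ← hgy, mul_inv_cancel_right]
      have hxy : x * y⁻¹ ∈ Y' := hlt.le (Subgroup.mem_comap.2 (hgx ▸ hg))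
      simpa using Y'.mul_mem hxy hy
end

section
/- The maximal subgroups of S_2 ≀ S_n = 𝔽_2^n ⋊ S_n whose projection onto S_n is all of S_n are, up to conjugation, exactly: G_1 = {(v,σ) : Σ_i v_i = 0} (for n ≥ 1); G_2 = {(v,σ) : Σ_i v_i = sgn σ} (for n ≥ 2), where sgn σ ∈ 𝔽_2 is 0 for even σ and 1 for odd σ; and G_3 = ⟨𝟏⟩ × S_n (for n ≥ 3 odd). For n = 1, G_2 = G_1 and G_3 is the whole group; for n even, G_3 ⊆ G_1. -/
open SemidirectProduct

noncomputable section

/-- The group `𝔽₂ⁿ` (written multiplicatively so as to form semidirect products). -/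
abbrev V (n : ℕ) := Fin n → Multiplicative (ZMod 2)

/-- The permutation action of `Sₙ` on `𝔽₂ⁿ`, as a homomorphism `Sₙ →* Aut(𝔽₂ⁿ)`. -/
def permAut (n : ℕ) : Equiv.Perm (Fin n) →* MulAut (V n) where
  toFun σ :=
    { toFun := fun v => v ∘ ⇑σ⁻¹
      invFun := fun v => v ∘ ⇑σ
      left_inv := fun v => by funext i; simp
      right_inv := fun v => by funext i; simp
      map_mul' := fun v w => rfl }
  map_one' := by ext v i; rfl
  map_mul' σ τ := by ext v i; rfl

/-- The wreath product `S₂ ≀ Sₙ = 𝔽₂ⁿ ⋊ Sₙ`. -/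
abbrev W (n : ℕ) := V n ⋊[permAut n] Equiv.Perm (Fin n)

/-- The sign of a permutation as an element of `𝔽₂`. -/
def sgn2 {n : ℕ} (σ : Equiv.Perm (Fin n)) : ZMod 2 :=
  if Equiv.Perm.sign σ = 1 then 0 else 1

/-- `G₁ = {(v, σ) : Σᵢ vᵢ = 0}`. -/
def G1set (n : ℕ) : Set (W n) :=
  {g | ∑ i, Multiplicative.toAdd (g.left i) = 0}

/-- `G₂ = {(v, σ) : Σᵢ vᵢ = sgn σ}`. -/
def G2set (n : ℕ) : Set (W n) :=
  {g | ∑ i, Multiplicative.toAdd (g.left i) = sgn2 g.right}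

/-- `G₃ = ⟨𝟏⟩ × Sₙ = {(v, σ) : v = 0 or v = 𝟏}`. -/
def G3set (n : ℕ) : Set (W n) :=
  {g | g.left = (fun _ => Multiplicative.ofAdd (0 : ZMod 2)) ∨
       g.left = fun _ => Multiplicative.ofAdd (1 : ZMod 2)}

theorem exists_mul_eq_of_apply_ne {n : ℕ} {v : V n} {i j : Fin n} (h : v i ≠ v j) :
    v * (v ∘ ⇑(Equiv.swap i j)⁻¹) =
      Pi.mulSingle i (Multiplicative.ofAdd 1) * Pi.mulSingle j (Multiplicative.ofAdd 1) := by
  have hZ : ∀ a b : Multiplicative (ZMod 2), a ≠ b → a * b = Multiplicative.ofAdd 1 := by decide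
  have hs : ∀ a : Multiplicative (ZMod 2), a * a = 1 := by decide
  have hij : i ≠ j := fun e => h (by rw [e])
  funext k
  by_cases hki : k = i
  · subst hki
    simp [hij, hZ _ _ h]
  · by_cases hkj : k = j
    · subst hkj
      simp [hij.symm, hZ _ _ h.symm]
    · simp [Equiv.swap_apply_of_ne_of_ne hki hkj, hki, hkj, hs]

/-- The isomorphism from `𝔽₂`, written multiplicatively, to `{±1}`, as a homomorphism. -/
def unitsHom : Multiplicative (ZMod 2) →* ℤˣ :=
  MonoidHom.mk' (fun a => if a = 1 then 1 else -1) (by decide)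

/-- The sign of a permutation as a homomorphism to `𝔽₂`, written multiplicatively. -/
def sgnHom (α : Type*) [Fintype α] [DecidableEq α] :
    Equiv.Perm α →* Multiplicative (ZMod 2) :=
  MonoidHom.mk' (fun σ => Multiplicative.ofAdd (if Equiv.Perm.sign σ = 1 then 0 else 1)) (by
    intro σ τ
    rcases Int.units_eq_one_or (Equiv.Perm.sign σ) with h | h <;>
    rcases Int.units_eq_one_or (Equiv.Perm.sign τ) with h' | h' <;>
    rw [Equiv.Perm.sign_mul, h, h'] <;> decide)

theorem perm_hom_eq_one_or_sgnHom {α : Type*} [Fintype α] [DecidableEq α]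
    (χ : Equiv.Perm α →* Multiplicative (ZMod 2)) : χ = 1 ∨ χ = sgnHom α := by
  have h1 : ∀ a, unitsHom a = 1 → a = 1 := by decide
  have h2 : ∀ a, a = Multiplicative.ofAdd (if unitsHom a = 1 then (0 : ZMod 2) else 1) := by
    decide
  by_cases hs : Function.Surjective (unitsHom.comp χ)
  · right
    have := Equiv.Perm.eq_sign_of_surjective_hom hs
    ext σ : 1
    rw [h2 (χ σ)]
    have e : unitsHom (χ σ) = Equiv.Perm.sign σ := DFunLike.congr_fun this σ
    rw [e]
    rfl
  · left
    ext σ : 1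
    rcases Int.units_eq_one_or (unitsHom (χ σ)) with h | h
    · exact h1 _ h
    · refine absurd (fun u => ?_) hs
      rcases Int.units_eq_one_or u with rfl | rfl
      · exact ⟨1, by simp⟩
      · exact ⟨σ, h⟩

/-- A 1-cocycle of the symmetric group in the permutation module over `𝔽₂` is a coboundary up to
a constant-valued cocycle. -/
theorem cocycle_eq {α : Type*} [Fintype α] [DecidableEq α] [Nonempty α]
    (c : Equiv.Perm α → α → Multiplicative (ZMod 2))
    (hc : ∀ σ τ i, c (σ * τ) i = c σ i * c τ (σ⁻¹ i)) :
    ∃ (w : α → Multiplicative (ZMod 2)) (ε : Equiv.Perm α → Multiplicative (ZMod 2)),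
      ∀ σ i, c σ i = ε σ * (w i * w (σ⁻¹ i)) := by
  obtain ⟨o⟩ := ‹Nonempty α›
  let χ : Equiv.Perm {x : α // x ≠ o} →* Multiplicative (ZMod 2) :=
    MonoidHom.mk' (fun σ => c (Equiv.Perm.ofSubtype σ) o) (by
      intro σ τ
      rw [map_mul, hc, ← map_inv, Equiv.Perm.ofSubtype_apply_of_not_mem _ (by simp)])
  obtain ⟨ε, hε⟩ : ∃ ε : Equiv.Perm α →* Multiplicative (ZMod 2),
      ∀ σ, σ o = o → c σ o = ε σ := by
    have key : ∀ σ : Equiv.Perm α, σ o = o →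
        ∃ τ : Equiv.Perm {x : α // x ≠ o}, Equiv.Perm.ofSubtype τ = σ := by
      intro σ hσ
      have hp : ∀ x, σ x ≠ o ↔ x ≠ o := fun x =>
        not_congr ⟨fun h => σ.injective (h.trans hσ.symm), fun h => h ▸ hσ⟩
      exact ⟨σ.subtypePerm hp, Equiv.Perm.ofSubtype_subtypePerm hp
        (fun x hx e => hx (by rw [e, hσ]))⟩
    rcases perm_hom_eq_one_or_sgnHom χ with h | h
    · refine ⟨1, fun σ hσ => ?_⟩
      obtain ⟨τ, rfl⟩ := key σ hσ
      exact DFunLike.congr_fun h τ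
    · refine ⟨sgnHom α, fun σ hσ => ?_⟩
      obtain ⟨τ, rfl⟩ := key σ hσ
      refine (DFunLike.congr_fun h τ).trans ?_
      change Multiplicative.ofAdd _ = Multiplicative.ofAdd _
      rw [Equiv.Perm.sign_ofSubtype]
  let w : α → Multiplicative (ZMod 2) := fun i => c (Equiv.swap o i) i * ε (Equiv.swap o i)
  have hw : ∀ σ, w (σ o) = c σ (σ o) * ε σ := by
    intro σ
    let ρ := Equiv.swap o (σ o)
    have hρ : ρ⁻¹ (σ o) = o := by simp [ρ]
    have h1 := hc ρ (ρ⁻¹ * σ) (σ o)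
    have h2 := hε (ρ⁻¹ * σ) hρ
    rw [mul_inv_cancel_left, hρ, h2] at h1
    have h3 : ε σ = ε ρ * ε (ρ⁻¹ * σ) := by rw [← map_mul, mul_inv_cancel_left]
    change c ρ (σ o) * ε ρ = _
    rw [h1, h3]
    generalize c ρ (σ o) = a, ε ρ = b, ε (ρ⁻¹ * σ) = d
    revert a b d
    decide
  refine ⟨w, ε, fun σ i => ?_⟩
  have hinv : σ (σ⁻¹ i) = i := σ.apply_symm_apply i
  have h1 := hw (Equiv.swap o (σ⁻¹ i))
  have h2 := hw (σ * Equiv.swap o (σ⁻¹ i))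
  have h3 := hc σ (Equiv.swap o (σ⁻¹ i)) i
  simp only [Equiv.Perm.mul_apply, Equiv.swap_apply_left, hinv, map_mul]
    at h1 h2
  rw [h1, h2, h3]
  generalize c σ i = a, ε σ = b, c (Equiv.swap o (σ⁻¹ i)) (σ⁻¹ i) = d,
    ε (Equiv.swap o (σ⁻¹ i)) = e
  revert a b d e
  decide

theorem wreath_mul_left_apply {n : ℕ} (a b : W n) (i : Fin n) :
    (a * b).left i = a.left i * b.left (a.right⁻¹ i) := rfl

theorem wreath_inv_left_apply {n : ℕ} (a : W n) (i : Fin n) :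
    a⁻¹.left i = (a.left (a.right i))⁻¹ := rfl

theorem conj_inl {n : ℕ} (g : W n) (v : V n) :
    g * inl v * g⁻¹ = inl (v ∘ ⇑g.right⁻¹) := by
  ext i : 2
  · simp only [wreath_mul_left_apply, wreath_inv_left_apply]
    simp
  · simp

/-- The sum of coordinates as a homomorphism to `𝔽₂`, written multiplicatively. -/
def sumHom (n : ℕ) : W n →* Multiplicative (ZMod 2) :=
  MonoidHom.mk' (fun g => ∏ i, g.left i) (by
    intro a b
    simp only [wreath_mul_left_apply, Finset.prod_mul_distrib]
    rw [Equiv.prod_comp a.right⁻¹ b.left])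

theorem sumHom_eq {n : ℕ} (g : W n) :
    sumHom n g = Multiplicative.ofAdd (∑ i, Multiplicative.toAdd (g.left i)) := by
  rw [ofAdd_sum]
  rfl

theorem sumHom_inl {n : ℕ} (v : V n) : sumHom n (inl v) = ∏ i, v i := rfl

theorem mem_G1set {n : ℕ} (g : W n) : g ∈ G1set n ↔ sumHom n g = 1 := by
  rw [sumHom_eq]
  exact Iff.rfl

theorem mem_G2set {n : ℕ} (g : W n) : g ∈ G2set n ↔ sumHom n g = sgnHom (Fin n) g.right := by
  rw [sumHom_eq]
  exact Iff.rfl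

theorem mem_G3set {n : ℕ} (g : W n) : g ∈ G3set n ↔ ∀ i j, g.left i = g.left j := by
  have hZ : ∀ a : Multiplicative (ZMod 2),
      a = Multiplicative.ofAdd (0 : ZMod 2) ∨ a = Multiplicative.ofAdd (1 : ZMod 2) := by decide
  constructor
  · rintro (h | h) i j <;> rw [h]
  · intro h
    rcases isEmpty_or_nonempty (Fin n) with hn | ⟨⟨o⟩⟩
    · exact Or.inl (funext fun i => isEmptyElim i)
    · exact (hZ (g.left o)).imp (fun e => funext fun i => (h i o).trans e)
        fun e => funext fun i => (h i o).trans e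

theorem conj_inl_mem_G3set {n : ℕ} (h : W n) (v : V n) :
    h⁻¹ * inl v * h ∈ G3set n ↔ ∀ i j, v i = v j := by
  have := conj_inl h⁻¹ v
  rw [inv_inv] at this
  rw [this, mem_G3set]
  constructor
  · intro H i j
    simpa using H (h.right⁻¹ i) (h.right⁻¹ j)
  · intro H i j
    exact H _ _

theorem exists_mem_right_eq {n : ℕ} {G : Subgroup (W n)}
    (hG : G.map (rightHom : W n →* _) = ⊤) (σ : Equiv.Perm (Fin n)) :
    ∃ g ∈ G, g.right = σ := by
  have : σ ∈ G.map (rightHom : W n →* _) := hG ▸ Subgroup.mem_top σ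
  exact this

theorem eq_inl_of_right_eq_one {n : ℕ} {g : W n} (h : g.right = 1) : g = inl g.left :=
  SemidirectProduct.ext rfl h

/-- A subgroup containing a nonconstant vector and projecting onto `Sₙ` contains every vector of
even weight. -/
theorem inl_mem_of_prod_eq_one {n : ℕ} {G : Subgroup (W n)}
    (hG : G.map (rightHom : W n →* _) = ⊤) {v : V n} (hv : inl v ∈ G) {i j : Fin n}
    (hij : v i ≠ v j) {u : V n} (hu : ∏ k, u k = 1) : inl u ∈ G := by
  have hne : i ≠ j := fun e => hij (by rw [e])
  have hconj : ∀ (u : V n) (σ : Equiv.Perm (Fin n)), inl u ∈ G → inl (u ∘ ⇑σ⁻¹) ∈ G := by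
    intro u σ hu
    obtain ⟨g, hg, rfl⟩ := exists_mem_right_eq hG σ
    rw [← conj_inl]
    exact G.mul_mem (G.mul_mem hg hu) (G.inv_mem hg)
  let ω : Multiplicative (ZMod 2) := Multiplicative.ofAdd 1
  have hpair : (inl (Pi.mulSingle i ω * Pi.mulSingle j ω) : W n) ∈ G := by
    rw [← exists_mul_eq_of_apply_ne hij, map_mul]
    exact G.mul_mem hv (hconj _ _ hv)
  have hpairs : ∀ k l, k ≠ l → (inl (Pi.mulSingle k ω * Pi.mulSingle l ω) : W n) ∈ G := by
    intro k l hkl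
    obtain ⟨σ, hσi, hσj⟩ : ∃ σ : Equiv.Perm (Fin n), σ k = i ∧ σ l = j := by
      refine ⟨Equiv.swap (Equiv.swap k i l) j * Equiv.swap k i, ?_, ?_⟩
      · rw [Equiv.Perm.mul_apply, Equiv.swap_apply_left, Equiv.swap_apply_of_ne_of_ne _ hne]
        intro e
        apply hkl
        apply (Equiv.swap k i).injective
        rw [← e, Equiv.swap_apply_left]
      · simp
    have := hconj _ σ⁻¹ hpair
    convert this using 2
    funext m
    subst hσi hσj
    simp [Pi.mulSingle_apply]
  have hs : ω * ω = 1 := by decide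
  have hZ : ∀ a : Multiplicative (ZMod 2), a = 1 ∨ a = ω := by decide
  have hone : u = ∏ k, (Pi.mulSingle k (u k) * Pi.mulSingle i (u k)) := by
    have h1 : ∏ k, (Pi.mulSingle i (u k) : V n) = 1 := by
      rw [← Pi.mulSingle_one i, ← hu]
      exact (map_prod (MonoidHom.mulSingle (fun _ : Fin n => Multiplicative (ZMod 2)) i) u
        Finset.univ).symm
    rw [Finset.prod_mul_distrib, h1, mul_one]
    exact (Finset.univ_prod_mulSingle u).symm
  change u ∈ G.comap (inl : V n →* W n)
  rw [hone]
  refine Subgroup.prod_mem _ fun k _ => ?_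
  rw [Subgroup.mem_comap]
  rcases hZ (u k) with h | h <;> rw [h]
  · simp
  · by_cases hk : k = i
    · rw [hk, ← Pi.mulSingle_mul, hs]
      simp
    · exact hpairs k i hk

theorem eq_top_of_inl_mem {n : ℕ} {G : Subgroup (W n)}
    (hG : G.map (rightHom : W n →* _) = ⊤) (h : ∀ v : V n, inl v ∈ G) : G = ⊤ := by
  refine (Subgroup.eq_top_iff' G).2 fun x => ?_
  obtain ⟨g, hg, e⟩ := exists_mem_right_eq hG x.right
  have : x * g⁻¹ ∈ G := by
    rw [eq_inl_of_right_eq_one (g := x * g⁻¹) (by simp [e])]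
    exact h _
  simpa using G.mul_mem this hg

theorem eq_top_of_prod_ne_one {n : ℕ} {G : Subgroup (W n)}
    (hG : G.map (rightHom : W n →* _) = ⊤) {v : V n} (hv : inl v ∈ G) {i j : Fin n}
    (hij : v i ≠ v j) {u : V n} (hu : inl u ∈ G) (hu1 : ∏ k, u k ≠ 1) : G = ⊤ := by
  have hZ : ∀ a b : Multiplicative (ZMod 2), a ≠ 1 → b ≠ 1 → b * a⁻¹ = 1 := by decide
  refine eq_top_of_inl_mem hG fun x => ?_
  by_cases hx : ∏ k, x k = 1
  · exact inl_mem_of_prod_eq_one hG hv hij hx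
  · have : inl (x * u⁻¹) ∈ G := inl_mem_of_prod_eq_one hG hv hij (by
      simp only [Pi.mul_apply, Pi.inv_apply, Finset.prod_mul_distrib, Finset.prod_inv_distrib]
      exact hZ _ _ hu1 hx)
    have := G.mul_mem this hu
    rwa [← map_mul, inv_mul_cancel_right] at this

theorem isCoatom_ker {A : Type*} [Group A] {θ : A →* Multiplicative (ZMod 2)} {a : A}
    (ha : θ a ≠ 1) : IsCoatom θ.ker := by
  have hZ : ∀ a b : Multiplicative (ZMod 2), a ≠ 1 → b ≠ 1 → b * a⁻¹ = 1 := by decide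
  refine ⟨fun h => ha (MonoidHom.mem_ker.1 (h ▸ Subgroup.mem_top a)), fun H hH => ?_⟩
  obtain ⟨hle, b, hbH, hb⟩ := SetLike.lt_iff_le_and_exists.1 hH
  refine (Subgroup.eq_top_iff' H).2 fun x => ?_
  by_cases hx : θ x = 1
  · exact hle hx
  · have : x * b⁻¹ ∈ H := hle (by
      rw [MonoidHom.mem_ker, map_mul, map_inv]
      exact hZ _ _ hb hx)
    simpa using H.mul_mem this hbH

/-- The elements whose coordinate sum agrees with a character of `Sₙ`. -/
def charSubgroup {n : ℕ} (χ : Equiv.Perm (Fin n) →* Multiplicative (ZMod 2)) : Subgroup (W n) :=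
  (sumHom n * χ.comp rightHom).ker

theorem mem_charSubgroup {n : ℕ} {χ : Equiv.Perm (Fin n) →* Multiplicative (ZMod 2)} {g : W n} :
    g ∈ charSubgroup χ ↔ sumHom n g = χ g.right := by
  have hZ : ∀ a b : Multiplicative (ZMod 2), a * b = 1 ↔ a = b := by decide
  exact hZ _ _

theorem conj_mem_charSubgroup {n : ℕ} {χ : Equiv.Perm (Fin n) →* Multiplicative (ZMod 2)}
    (h g : W n) : h⁻¹ * g * h ∈ charSubgroup χ ↔ g ∈ charSubgroup χ := by
  simp only [charSubgroup, MonoidHom.mem_ker, map_mul, map_inv]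
  rw [mul_right_comm, inv_mul_cancel, one_mul]

theorem charSubgroup_isCoatom {n : ℕ} (hn : 1 ≤ n)
    (χ : Equiv.Perm (Fin n) →* Multiplicative (ZMod 2)) :
    IsCoatom (charSubgroup χ) ∧ (charSubgroup χ).map (rightHom : W n →* _) = ⊤ := by
  constructor
  · apply isCoatom_ker (a := (inl (Pi.mulSingle ⟨0, hn⟩ (Multiplicative.ofAdd 1) : V n) : W n))
    simp [sumHom_inl]
  · refine (Subgroup.eq_top_iff' _).2 fun σ =>
      ⟨⟨Pi.mulSingle ⟨0, hn⟩ (χ σ), σ⟩, mem_charSubgroup.2 ?_, rfl⟩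
    change ∏ i, (Pi.mulSingle ⟨0, hn⟩ (χ σ) : V n) i = _
    simp

theorem le_charSubgroup {n : ℕ} {G : Subgroup (W n)}
    (hG : G.map (rightHom : W n →* _) = ⊤) (h : ∀ v : V n, inl v ∈ G → ∏ i, v i = 1) :
    ∃ χ, G ≤ charSubgroup χ := by
  choose f hf hfr using exists_mem_right_eq hG
  have key : ∀ a ∈ G, ∀ b ∈ G, a.right = b.right → sumHom n a = sumHom n b := by
    intro a ha b hb e
    have hr : (a * b⁻¹).right = 1 := by simp [e]
    have := h (a * b⁻¹).left (by
      rw [← eq_inl_of_right_eq_one hr]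
      exact G.mul_mem ha (G.inv_mem hb))
    rw [← sumHom_inl, ← eq_inl_of_right_eq_one hr, map_mul, map_inv] at this
    exact mul_inv_eq_one.1 this
  refine ⟨MonoidHom.mk' (fun σ => sumHom n (f σ)) fun σ τ => ?_, fun g hg =>
    mem_charSubgroup.2 (key _ hg _ (hf _) (hfr _).symm)⟩
  rw [← map_mul]
  exact key _ (hf _) _ (G.mul_mem (hf _) (hf _)) (by simp [hfr])

theorem prod_const_of_odd {n : ℕ} (hn : Odd n) (a : Multiplicative (ZMod 2)) :
    ∏ _i : Fin n, a = a := by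
  have hs : a * a = 1 := by revert a; decide
  obtain ⟨k, rfl⟩ := hn
  rw [Finset.prod_const, Finset.card_univ, Fintype.card_fin, pow_succ, pow_mul, pow_two, hs,
    one_pow, one_mul]

/-- A subgroup meeting `𝔽₂ⁿ` exactly in the constant vectors, `n` odd, is conjugate to `G₃`. -/
theorem exists_conj_G3set {n : ℕ} (hn : Odd n) {G : Subgroup (W n)}
    (hG : G.map (rightHom : W n →* _) = ⊤)
    (h : ∀ v : V n, inl v ∈ G ↔ ∀ i j, v i = v j) :
    ∃ x : W n, (G : Set (W n)) = {g | x⁻¹ * g * x ∈ G3set n} := by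
  have hs : ∀ a : Multiplicative (ZMod 2), a * a = 1 := by decide
  let o : Fin n := ⟨0, hn.pos⟩
  have : Nonempty (Fin n) := ⟨o⟩
  have hex : ∀ σ : Equiv.Perm (Fin n), ∃ g ∈ G, g.right = σ ∧ sumHom n g = 1 := by
    intro σ
    obtain ⟨g, hg, e⟩ := exists_mem_right_eq hG σ
    refine ⟨inl (fun _ => sumHom n g) * g, G.mul_mem ((h _).2 fun _ _ => rfl) hg, by simp [e], ?_⟩
    rw [map_mul, sumHom_inl, prod_const_of_odd hn, hs]
  choose f hf hfr hfs using hex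
  have key : ∀ a ∈ G, ∀ b ∈ G, a.right = b.right → sumHom n a = 1 → sumHom n b = 1 → a = b := by
    intro a ha b hb e ha1 hb1
    have hr : (a * b⁻¹).right = 1 := by simp [e]
    have hx := eq_inl_of_right_eq_one hr
    have hc := (h (a * b⁻¹).left).1 (by
      rw [← hx]
      exact G.mul_mem ha (G.inv_mem hb))
    have hv : (a * b⁻¹).left = fun _ => (a * b⁻¹).left o := funext fun i => hc i o
    have h1 : sumHom n (a * b⁻¹) = 1 := by simp [ha1, hb1]
    rw [hx, hv, sumHom_inl, prod_const_of_odd hn] at h1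
    rw [h1] at hv
    rw [hv] at hx
    refine mul_inv_eq_one.1 (hx.trans ?_)
    exact map_one inl
  have hmul : ∀ σ τ, f (σ * τ) = f σ * f τ := fun σ τ =>
    key _ (hf _) _ (G.mul_mem (hf _) (hf _)) (by simp [hfr]) (hfs _) (by simp [hfs])
  obtain ⟨w, ε, hw⟩ := cocycle_eq (fun σ => (f σ).left) (fun σ τ i => by
    rw [hmul, wreath_mul_left_apply, hfr])
  refine ⟨inl w, Set.ext fun g => ?_⟩
  have hr : (g * (f g.right)⁻¹).right = 1 := by simp [hfr]
  have h1 : g ∈ G ↔ g * (f g.right)⁻¹ ∈ G :=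
    (G.mul_mem_cancel_right (G.inv_mem (hf _))).symm
  rw [SetLike.mem_coe, h1, eq_inl_of_right_eq_one hr, h, Set.mem_ofPred_eq, mem_G3set]
  refine forall₂_congr fun i j => ?_
  have e1 : ∀ i, (g * (f g.right)⁻¹).left i
      = ε g.right * (g.left i * (w i * w (g.right⁻¹ i))) := by
    intro i
    have hinv : g.right (g.right⁻¹ i) = i := g.right.apply_symm_apply i
    have := hw g.right i
    simp only [wreath_mul_left_apply, wreath_inv_left_apply, hfr, hinv, this]
    generalize g.left i = a, ε g.right = b, w i = d, w (g.right⁻¹ i) = e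
    revert a b d e
    decide
  have e2 : ∀ i, ((inl w)⁻¹ * g * inl w : W n).left i
      = g.left i * (w i * w (g.right⁻¹ i)) := by
    intro i
    simp only [wreath_mul_left_apply, wreath_inv_left_apply]
    simp only [left_inl, right_inl, SemidirectProduct.mul_right, SemidirectProduct.inv_right,
      Equiv.Perm.one_apply, inv_one, one_mul]
    generalize g.left i = a, w i = d, w (g.right⁻¹ i) = e
    revert a d e
    decide
  rw [e1, e1, e2, e2, mul_right_inj]

theorem isCoatom_of_eq_conj_G3set {n : ℕ} (hn : Odd n) (h3 : 3 ≤ n) {G : Subgroup (W n)} {x : W n}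
    (hG : (G : Set (W n)) = {g | x⁻¹ * g * x ∈ G3set n}) :
    IsCoatom G ∧ G.map (rightHom : W n →* _) = ⊤ := by
  have hmem : ∀ g, g ∈ G ↔ x⁻¹ * g * x ∈ G3set n := fun g => Set.ext_iff.1 hG g
  have hinl : ∀ v : V n, inl v ∈ G ↔ ∀ i j, v i = v j := fun v =>
    (hmem _).trans (conj_inl_mem_G3set x v)
  have hsurj : G.map (rightHom : W n →* _) = ⊤ := by
    refine (Subgroup.eq_top_iff' _).2 fun σ =>
      ⟨x * inr (x.right⁻¹ * σ * x.right) * x⁻¹, (hmem _).2 ?_, ?_⟩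
    · rw [mem_G3set]
      intro i j
      simp [mul_assoc]
    · simp [mul_assoc]
  refine ⟨⟨fun h => ?_, fun H hH => ?_⟩, hsurj⟩
  · have := (hinl (Pi.mulSingle ⟨0, by omega⟩ (Multiplicative.ofAdd 1))).1 (h ▸ Subgroup.mem_top _)
      ⟨0, by omega⟩ ⟨1, by omega⟩
    simp at this
  · obtain ⟨hle, y, hyH, hy⟩ := SetLike.lt_iff_le_and_exists.1 hH
    have hHs : H.map (rightHom : W n →* _) = ⊤ := top_le_iff.1 (hsurj ▸ Subgroup.map_mono hle)
    obtain ⟨g, hg, e⟩ := exists_mem_right_eq hsurj y.right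
    have hr : (y * g⁻¹).right = 1 := by simp [e]
    have hz := eq_inl_of_right_eq_one hr
    have hzH : inl (y * g⁻¹).left ∈ H := hz ▸ H.mul_mem hyH (H.inv_mem (hle hg))
    have hzG : inl (y * g⁻¹).left ∉ G := by
      rw [← hz, G.mul_mem_cancel_right (G.inv_mem hg)]
      exact hy
    rw [hinl] at hzG
    push Not at hzG
    obtain ⟨i, j, hij⟩ := hzG
    refine eq_top_of_prod_ne_one hHs hzH hij
      (hle ((hinl fun _ => Multiplicative.ofAdd 1).2 fun _ _ => rfl)) ?_
    rw [prod_const_of_odd hn]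
    decide

theorem conj_G1set_eq {n : ℕ} (h : W n) :
    {g | h⁻¹ * g * h ∈ G1set n} = (charSubgroup (n := n) 1 : Set (W n)) := by
  ext g
  exact (mem_G1set _).trans (mem_charSubgroup.symm.trans (conj_mem_charSubgroup (χ := 1) h g))

theorem conj_G2set_eq {n : ℕ} (h : W n) :
    {g | h⁻¹ * g * h ∈ G2set n} = (charSubgroup (sgnHom (Fin n)) : Set (W n)) := by
  ext g
  exact (mem_G2set _).trans (mem_charSubgroup.symm.trans (conj_mem_charSubgroup h g))

theorem sgnHom_of_le_one {n : ℕ} (hn : n ≤ 1) : sgnHom (Fin n) = 1 := by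
  have : Subsingleton (Fin n) := Fin.subsingleton_iff_le_one.2 hn
  ext σ : 1
  rw [Subsingleton.elim σ 1, map_one, map_one]

/-- **Theorem 3.5**: the maximal subgroups of `S₂ ≀ Sₙ = 𝔽₂ⁿ ⋊ Sₙ` whose projection to
`Sₙ` is surjective are, up to conjugation, exactly: `G₁` (for `n ≥ 1`), `G₂` (for
`n ≥ 2`) and `G₃` (for `n ≥ 3` odd).  Moreover for `n = 1` one has `G₂ = G₁` and
`G₃ = S₂ ≀ Sₙ`, while for `n` even `G₃ ⊆ G₁`. -/
theorem maximal_subgroups_wreath (n : ℕ) (hn : 1 ≤ n) :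
    (∀ G : Subgroup (W n),
      (IsCoatom G ∧ Subgroup.map (SemidirectProduct.rightHom : W n →* _) G = ⊤) ↔
        ((∃ h : W n, (G : Set (W n)) = {g | h⁻¹ * g * h ∈ G1set n}) ∨
         (2 ≤ n ∧ ∃ h : W n, (G : Set (W n)) = {g | h⁻¹ * g * h ∈ G2set n}) ∨
         (3 ≤ n ∧ Odd n ∧ ∃ h : W n, (G : Set (W n)) = {g | h⁻¹ * g * h ∈ G3set n}))) ∧
    (n = 1 → G2set n = G1set n ∧ G3set n = Set.univ) ∧
    (Even n → G3set n ⊆ G1set n) := by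
  refine ⟨fun G => ⟨?_, ?_⟩, ?_, ?_⟩
  · rintro ⟨hmax, hG⟩
    by_cases hsum : ∀ v : V n, inl v ∈ G → ∏ i, v i = 1
    · obtain ⟨χ, hχ⟩ := le_charSubgroup hG hsum
      have hGχ : G = charSubgroup χ := by
        rcases hmax.le_iff.1 hχ with h | h
        · exact absurd h (charSubgroup_isCoatom hn χ).1.1
        · exact h.symm
      by_cases h1 : χ = 1
      · left
        exact ⟨1, by rw [conj_G1set_eq, hGχ, h1]⟩
      · have h2 := (perm_hom_eq_one_or_sgnHom χ).resolve_left h1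
        refine Or.inr (Or.inl ⟨?_, 1, by rw [conj_G2set_eq, hGχ, h2]⟩)
        by_contra hlt
        exact h1 (h2.trans (sgnHom_of_le_one (by omega)))
    · push Not at hsum
      obtain ⟨u, hu, hu1⟩ := hsum
      have hconst : ∀ v : V n, inl v ∈ G → ∀ i j, v i = v j := by
        intro v hv i j
        by_contra hij
        exact hmax.1 (eq_top_of_prod_ne_one hG hv hij hu hu1)
      have hZ : ∀ a b : Multiplicative (ZMod 2), a ≠ 1 → b = 1 ∨ b = a := by decide
      have hs : ∀ a : Multiplicative (ZMod 2), a ^ 2 = 1 := by decide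
      have hu0 : u = fun _ => u ⟨0, hn⟩ := funext fun i => hconst u hu i _
      generalize u ⟨0, hn⟩ = a at hu0
      subst hu0
      have hodd : Odd n := by
        by_contra hev
        obtain ⟨k, hk⟩ := (Nat.not_odd_iff_even.1 hev).two_dvd
        apply hu1
        rw [Finset.prod_const, Finset.card_univ, Fintype.card_fin, hk, pow_mul, hs, one_pow]
      rw [prod_const_of_odd hodd] at hu1
      have hiff : ∀ v : V n, inl v ∈ G ↔ ∀ i j, v i = v j := by
        refine fun v => ⟨hconst v, fun hv => ?_⟩
        have hv0 : v = fun _ => v ⟨0, hn⟩ := funext fun i => hv i _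
        rcases hZ a (v ⟨0, hn⟩) hu1 with h | h
        · rw [h] at hv0
          rw [hv0]
          exact (map_one (inl : V n →* W n)) ▸ G.one_mem
        · rw [hv0, h]
          exact hu
      refine Or.inr (Or.inr ⟨?_, hodd, exists_conj_G3set hodd hG hiff⟩)
      by_contra hlt
      have h1 : n = 1 := by
        obtain ⟨k, hk⟩ := hodd
        omega
      subst h1
      exact hmax.1 (eq_top_of_inl_mem hG fun v => (hiff v).2 fun i j => by
        rw [Subsingleton.elim i j])
  · rintro (⟨h, hG⟩ | ⟨-, h, hG⟩ | ⟨h3, hodd, h, hG⟩)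
    · rw [conj_G1set_eq] at hG
      rw [SetLike.coe_injective hG]
      exact charSubgroup_isCoatom hn _
    · rw [conj_G2set_eq] at hG
      rw [SetLike.coe_injective hG]
      exact charSubgroup_isCoatom hn _
    · exact isCoatom_of_eq_conj_G3set hodd h3 hG
  · rintro rfl
    constructor
    · ext g
      rw [mem_G1set, mem_G2set, sgnHom_of_le_one le_rfl]
      rfl
    · refine Set.eq_univ_of_forall fun g => (mem_G3set g).2 fun i j => ?_
      rw [Subsingleton.elim i j]
  · rintro ⟨k, hk⟩ g hg
    have hs : ∀ a : ZMod 2, a + a = 0 := by decide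
    rcases hg with h | h <;> simp only [G1set, Set.mem_ofPred_eq, h] <;> simp [hk, hs]

end
end

section
/- The number of triples of integers (x, y, z) with 1 ≤ x, y, z ≤ H satisfying x y = z^2 is Θ(H log H), i.e., bounded above and below by positive constant multiples of H log H for all H ≥ 2. -/
open Finset in
/-- Triples `(g, a, b)` with `g ∈ s` and `1 ≤ a, b ≤ √(H / g)`. -/
def sqrtBoxes (s : Finset ℕ) (H : ℕ) : Finset (Σ _ : ℕ, ℕ × ℕ) :=
  s.sigma fun g => Icc 1 (Nat.sqrt (H / g)) ×ˢ Icc 1 (Nat.sqrt (H / g))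

theorem card_sqrtBoxes (s : Finset ℕ) (H : ℕ) :
    (sqrtBoxes s H).card = ∑ g ∈ s, Nat.sqrt (H / g) ^ 2 := by
  simp [sqrtBoxes, Finset.card_sigma, sq]

theorem le_sqrt_div_iff {g a H : ℕ} (hg : 0 < g) : a ≤ Nat.sqrt (H / g) ↔ g * a ^ 2 ≤ H := by
  rw [Nat.le_sqrt', Nat.le_div_iff_mul_le hg, mul_comm]

theorem exists_eq_mul_sq_of_mul_eq_sq {x y z : ℕ} (hx : 0 < x) (h : x * y = z ^ 2) :
    ∃ g a b : ℕ, x = g * a ^ 2 ∧ y = g * b ^ 2 ∧ z = g * (a * b) := by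
  obtain ⟨g, u, v, hg, huv, rfl, rfl⟩ := Nat.exists_coprime' (Nat.gcd_pos_of_pos_left y hx)
  have hgz : g ∣ z := by
    rw [← Nat.pow_dvd_pow_iff two_ne_zero, ← h]
    exact ⟨u * v, by ring⟩
  obtain ⟨w, rfl⟩ := hgz
  have hw : u * v = w ^ 2 := by
    apply Nat.eq_of_mul_eq_mul_left (pow_pos hg 2)
    linarith
  obtain ⟨a, rfl⟩ := exists_eq_pow_of_mul_eq_pow (Nat.isUnit_iff.2 huv) hw
  obtain ⟨b, rfl⟩ := exists_eq_pow_of_mul_eq_pow (Nat.isUnit_iff.2 huv.symm)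
    ((mul_comm _ _).trans hw)
  refine ⟨g, a, b, mul_comm _ _, mul_comm _ _, ?_⟩
  rw [← mul_pow] at hw
  rw [Nat.pow_left_injective two_ne_zero hw]

theorem Squarefree.eq_of_mul_sq_eq_mul_sq {g g' a a' : ℕ} (hg : Squarefree g)
    (hg' : Squarefree g') (ha : 0 < a) (h : g * a ^ 2 = g' * a' ^ 2) : g = g' := by
  have hdvd : a ∣ g' * a' := by
    rw [← Nat.pow_dvd_pow_iff two_ne_zero]
    exact ⟨g * g', by linear_combination g' * h.symm⟩
  obtain ⟨k, hk⟩ := hdvd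
  have hkk : g * g' = k ^ 2 := by
    apply Nat.eq_of_mul_eq_mul_left (pow_pos ha 2)
    calc a ^ 2 * (g * g') = g' * (g * a ^ 2) := by ring
      _ = (g' * a') ^ 2 := by rw [h]; ring
      _ = a ^ 2 * k ^ 2 := by rw [hk]; ring
  obtain ⟨t, rfl⟩ := (hg.dvd_pow_iff_dvd two_ne_zero).1 (hkk ▸ Dvd.intro g' rfl)
  have hgt : g' = g * (t * t) := by
    apply Nat.eq_of_mul_eq_mul_left (Nat.pos_of_ne_zero hg.ne_zero)
    linarith
  have ht : t = 1 := Nat.isUnit_iff.1 (hg' t (hgt ▸ Dvd.intro_left g rfl))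
  simp [hgt, ht]

theorem sum_Icc_inv_sq_le_two (H : ℕ) : ∑ m ∈ Finset.Icc 1 H, ((m : ℝ) ^ 2)⁻¹ ≤ 2 := by
  rcases Nat.eq_zero_or_pos H with rfl | hH
  · simp
  · rw [← Finset.add_sum_Ioc_eq_sum_Icc hH]
    have h := sum_Ioc_inv_sq_le_sub (α := ℝ) one_ne_zero hH
    have : (0 : ℝ) ≤ (H : ℝ)⁻¹ := by positivity
    norm_num at h ⊢
    linarith

theorem harmonic_eq_sum_Icc_inv (H : ℕ) :
    (harmonic H : ℝ) = ∑ n ∈ Finset.Icc 1 H, (n : ℝ)⁻¹ := by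
  simp [harmonic_eq_sum_Icc]

theorem harmonic_le_two_mul_sum_squarefree (H : ℕ) :
    (harmonic H : ℝ) ≤ 2 * ∑ g ∈ Finset.Icc 1 H with Squarefree g, (g : ℝ)⁻¹ := by
  choose! G M hGpos hMpos hGM hG using fun n (hn : 0 < n) => Nat.sq_mul_squarefree_of_pos hn
  have hinj : Set.InjOn (fun n => (G n, M n)) (Finset.Icc 1 H : Finset ℕ) := by
    intro n hn n' hn' h
    simp only [Finset.coe_Icc, Set.mem_Icc, Prod.mk.injEq] at hn hn' h
    rw [← hGM n hn.1, ← hGM n' hn'.1, h.1, h.2]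
  calc (harmonic H : ℝ) = ∑ n ∈ Finset.Icc 1 H, (n : ℝ)⁻¹ := harmonic_eq_sum_Icc_inv H
    _ = ∑ n ∈ Finset.Icc 1 H, ((G n : ℝ)⁻¹ * ((M n : ℝ) ^ 2)⁻¹) := by
        refine Finset.sum_congr rfl fun n hn => ?_
        have h := hGM n (Finset.mem_Icc.1 hn).1
        rw [← mul_inv, mul_comm]
        congr 1
        exact_mod_cast h.symm
    _ = ∑ p ∈ (Finset.Icc 1 H).image (fun n => (G n, M n)),
          ((p.1 : ℝ)⁻¹ * ((p.2 : ℝ) ^ 2)⁻¹) := by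
        rw [Finset.sum_image hinj]
    _ ≤ ∑ p ∈ ({g ∈ Finset.Icc 1 H | Squarefree g}) ×ˢ Finset.Icc 1 H,
          ((p.1 : ℝ)⁻¹ * ((p.2 : ℝ) ^ 2)⁻¹) := by
        refine Finset.sum_le_sum_of_subset_of_nonneg ?_ fun _ _ _ => by positivity
        intro p hp
        obtain ⟨n, hn, rfl⟩ := Finset.mem_image.1 hp
        obtain ⟨hn1, hnH⟩ := Finset.mem_Icc.1 hn
        have h1 : G n ≤ n := Nat.le_of_dvd hn1 ⟨M n ^ 2, by rw [mul_comm, hGM n hn1]⟩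
        have h2 : M n ≤ n := Nat.le_of_dvd hn1 ⟨M n * G n, by rw [← mul_assoc, ← sq, hGM n hn1]⟩
        simp only [Finset.mem_product, Finset.mem_filter, Finset.mem_Icc]
        exact ⟨⟨⟨hGpos n hn1, h1.trans hnH⟩, hG n hn1⟩, hMpos n hn1, h2.trans hnH⟩
    _ = (∑ g ∈ Finset.Icc 1 H with Squarefree g, (g : ℝ)⁻¹) *
          ∑ m ∈ Finset.Icc 1 H, ((m : ℝ) ^ 2)⁻¹ := by
        rw [Finset.sum_mul_sum, Finset.sum_product]
    _ ≤ (∑ g ∈ Finset.Icc 1 H with Squarefree g, (g : ℝ)⁻¹) * 2 := by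
        refine mul_le_mul_of_nonneg_left (sum_Icc_inv_sq_le_two H) ?_
        exact Finset.sum_nonneg fun _ _ => by positivity
    _ = _ := mul_comm _ _

theorem card_sqrtBoxes_Icc_le (H : ℕ) :
    ((sqrtBoxes (Finset.Icc 1 H) H).card : ℝ) ≤ H * harmonic H := by
  rw [card_sqrtBoxes, harmonic_eq_sum_Icc_inv, Finset.mul_sum]
  push_cast
  refine Finset.sum_le_sum fun g hg => ?_
  have hg0 : 0 < g := (Finset.mem_Icc.1 hg).1
  have h : g * Nat.sqrt (H / g) ^ 2 ≤ H := (le_sqrt_div_iff hg0).1 le_rfl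
  have hgR : (0 : ℝ) < g := by exact_mod_cast hg0
  rw [← div_eq_mul_inv, le_div_iff₀ hgR, mul_comm]
  exact_mod_cast h

theorem le_card_sqrtBoxes {s : Finset ℕ} {H : ℕ} (hs : s ⊆ Finset.Icc 1 H) :
    (H : ℝ) * (∑ g ∈ s, (g : ℝ)⁻¹) ≤ 4 * (sqrtBoxes s H).card := by
  rw [card_sqrtBoxes, Finset.mul_sum]
  push_cast
  rw [Finset.mul_sum]
  refine Finset.sum_le_sum fun g hg => ?_
  obtain ⟨hg0, hgH⟩ := Finset.mem_Icc.1 (hs hg)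
  have h1 : 1 ≤ Nat.sqrt (H / g) := (le_sqrt_div_iff hg0).2 (by simpa using hgH)
  have h2 : H < g * (Nat.sqrt (H / g) + 1) ^ 2 := by
    rw [← not_le, ← le_sqrt_div_iff hg0]
    exact Nat.not_succ_le_self _
  have hgR : (0 : ℝ) < g := by exact_mod_cast hg0
  rw [← div_eq_mul_inv, div_le_iff₀ hgR]
  have h3 : H ≤ 4 * Nat.sqrt (H / g) ^ 2 * g :=
    calc H ≤ g * (Nat.sqrt (H / g) + 1) ^ 2 := h2.le
      _ ≤ g * (2 * Nat.sqrt (H / g)) ^ 2 := by gcongr; omega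
      _ = 4 * Nat.sqrt (H / g) ^ 2 * g := by ring
  exact_mod_cast h3

/-- The integer points of `[1, H]³` on the surface `x y = z²`. -/
abbrev squareProductTriples (H : ℕ) : Finset (ℕ × ℕ × ℕ) :=
  (Finset.Icc 1 H ×ˢ Finset.Icc 1 H ×ˢ Finset.Icc 1 H).filter
    (fun t : ℕ × ℕ × ℕ => t.1 * t.2.1 = t.2.2 ^ 2)

theorem card_squareProductTriples_le (H : ℕ) :
    (squareProductTriples H).card ≤ (sqrtBoxes (Finset.Icc 1 H) H).card := by
  refine Finset.card_le_card_of_surjOn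
    (fun p => (p.1 * p.2.1 ^ 2, p.1 * p.2.2 ^ 2, p.1 * (p.2.1 * p.2.2))) ?_
  rintro ⟨x, y, z⟩ ht
  simp only [Finset.coe_filter, Finset.mem_product, Finset.mem_Icc, Set.mem_ofPred_eq] at ht
  obtain ⟨⟨⟨hx, hxH⟩, ⟨hy, hyH⟩, -⟩, h⟩ := ht
  obtain ⟨g, a, b, rfl, rfl, rfl⟩ := exists_eq_mul_sq_of_mul_eq_sq hx h
  have hg : 0 < g := Nat.pos_of_mul_pos_right hx
  have ha : 0 < a := Nat.pos_of_ne_zero (by rintro rfl; simp at hx)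
  have hb : 0 < b := Nat.pos_of_ne_zero (by rintro rfl; simp at hy)
  refine ⟨⟨g, a, b⟩, ?_, rfl⟩
  simp only [sqrtBoxes, Finset.coe_sigma, Set.mem_sigma_iff, Finset.mem_coe, Finset.mem_product,
    Finset.mem_Icc, le_sqrt_div_iff hg]
  exact ⟨⟨hg, (Nat.le_mul_of_pos_right g (pow_pos ha 2)).trans hxH⟩, ⟨ha, hxH⟩, hb, hyH⟩

theorem card_sqrtBoxes_squarefree_le (H : ℕ) :
    (sqrtBoxes {g ∈ Finset.Icc 1 H | Squarefree g} H).card ≤ (squareProductTriples H).card := by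
  refine Finset.card_le_card_of_injOn
    (fun p => (p.1 * p.2.1 ^ 2, p.1 * p.2.2 ^ 2, p.1 * (p.2.1 * p.2.2))) ?_ ?_
  · rintro ⟨g, a, b⟩ hp
    simp only [sqrtBoxes, Finset.coe_sigma, Set.mem_sigma_iff, Finset.mem_coe,
      Finset.mem_product, Finset.mem_filter, Finset.mem_Icc] at hp
    obtain ⟨⟨⟨hg, -⟩, -⟩, ⟨ha, haH⟩, hb, hbH⟩ := hp
    have hab : g * (a * b) ≤ H := by
      rcases le_total a b with hle | hle
      · refine le_trans ?_ ((le_sqrt_div_iff hg).1 hbH)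
        rw [sq]; gcongr
      · refine le_trans ?_ ((le_sqrt_div_iff hg).1 haH)
        rw [sq]; gcongr
    rw [le_sqrt_div_iff hg] at haH hbH
    simp only [Finset.coe_filter, Finset.mem_product, Finset.mem_Icc, Set.mem_ofPred_eq]
    exact ⟨⟨⟨Nat.mul_pos hg (pow_pos ha 2), haH⟩, ⟨Nat.mul_pos hg (pow_pos hb 2), hbH⟩,
      Nat.mul_pos hg (Nat.mul_pos ha hb), hab⟩, by ring⟩
  · rintro ⟨g, a, b⟩ hp ⟨g', a', b'⟩ hp' h
    simp only [sqrtBoxes, Finset.coe_sigma, Set.mem_sigma_iff, Finset.mem_coe,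
      Finset.mem_product, Finset.mem_filter, Finset.mem_Icc] at hp hp'
    simp only [Prod.mk.injEq] at h
    obtain rfl := hp.1.2.eq_of_mul_sq_eq_mul_sq hp'.1.2 hp.2.1.1 h.1
    have ha := Nat.pow_left_injective two_ne_zero (Nat.eq_of_mul_eq_mul_left hp.1.1.1 h.1)
    have hb := Nat.pow_left_injective two_ne_zero (Nat.eq_of_mul_eq_mul_left hp.1.1.1 h.2.1)
    rw [ha, hb]


/-- **Lemma 4.2**: the number of integer triples `(x, y, z)` with `1 ≤ x, y, z ≤ H`
and `x y = z²` is `Θ(H log H)` for `H ≥ 2`. -/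
theorem count_xy_eq_square :
    ∃ c₁ c₂ : ℝ, 0 < c₁ ∧ 0 < c₂ ∧ ∀ H : ℕ, 2 ≤ H →
      c₁ * (H : ℝ) * Real.log H ≤
        (((Finset.Icc 1 H ×ˢ Finset.Icc 1 H ×ˢ Finset.Icc 1 H).filter
          (fun t : ℕ × ℕ × ℕ => t.1 * t.2.1 = t.2.2 ^ 2)).card : ℝ) ∧
      (((Finset.Icc 1 H ×ˢ Finset.Icc 1 H ×ˢ Finset.Icc 1 H).filter
          (fun t : ℕ × ℕ × ℕ => t.1 * t.2.1 = t.2.2 ^ 2)).card : ℝ) ≤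
        c₂ * (H : ℝ) * Real.log H := by
  refine ⟨1 / 8, 3, by norm_num, by norm_num, fun H hH => ⟨?_, ?_⟩⟩
  · have hcard : ((sqrtBoxes {g ∈ Finset.Icc 1 H | Squarefree g} H).card : ℝ) ≤
        (squareProductTriples H).card := by exact_mod_cast card_sqrtBoxes_squarefree_le H
    have hbox := le_card_sqrtBoxes (Finset.filter_subset Squarefree (Finset.Icc 1 H))
    have hlog : Real.log H ≤ harmonic H :=
      (Real.log_le_log (by positivity) (by simp)).trans (log_add_one_le_harmonic H)
    have hsum := mul_le_mul_of_nonneg_left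
      (hlog.trans (harmonic_le_two_mul_sum_squarefree H)) (Nat.cast_nonneg (α := ℝ) H)
    linarith
  · have hcard : ((squareProductTriples H).card : ℝ) ≤
        (sqrtBoxes (Finset.Icc 1 H) H).card := by exact_mod_cast card_squareProductTriples_le H
    have hlog : Real.log 2 ≤ Real.log H :=
      Real.log_le_log (by norm_num) (by exact_mod_cast hH)
    have hharm : (harmonic H : ℝ) ≤ 3 * Real.log H := by
      linarith [harmonic_le_one_add_log H, Real.log_two_gt_d9]
    have hmul := mul_le_mul_of_nonneg_left hharm (Nat.cast_nonneg (α := ℝ) H)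
    linarith [card_sqrtBoxes_Icc_le H]
end

section
/- Fix n and an integer k ≥ 0. For every prime p, the number of homogeneous binary forms g ∈ 𝔽_p[x,y] of degree n such that y divides g (equivalently g(1,0) = 0) and ind(g) ≥ k is O(p^{n−k}), with implied constant depending only on n. -/
open Polynomial

noncomputable section

/-- The dehomogenization `g(x, 1)` of the binary form of degree `n` with coefficient
vector `w` (where `w i` is the coefficient of `xⁱ yⁿ⁻ⁱ`). -/
def dehom {R : Type*} [CommRing R] (n : ℕ) (w : Fin (n + 1) → R) : Polynomial R :=
  ∑ i : Fin (n + 1), Polynomial.C (w i) * Polynomial.X ^ (i : ℕ)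

open scoped Classical in
/-- The index `ind(g) = Σᵢ (eᵢ - 1) deg Pᵢ` of a nonzero binary form `g = ∏ᵢ Pᵢ^eᵢ` of
degree `n` over a field, computed from its coefficient vector `w`: it equals `n` minus
the total degree of the distinct irreducible factors.  (Here the factor `y` contributes
through the drop in degree of the dehomogenization `g(x,1)`.) -/
def binIndex {K : Type*} [Field K] (n : ℕ) (w : Fin (n + 1) → K) : ℕ :=
  n - (∑ q ∈ (UniqueFactorizationMonoid.normalizedFactors (dehom n w)).toFinset, q.natDegree)
    - (if (dehom n w).natDegree < n then 1 else 0)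

open UniqueFactorizationMonoid

theorem dehom_coeff {R : Type*} [CommRing R] {n : ℕ} (w : Fin (n + 1) → R) (i : Fin (n + 1)) :
    (dehom n w).coeff i = w i := by
  simp [dehom, Polynomial.coeff_C_mul, Polynomial.coeff_X_pow, Fin.val_inj]

theorem dehom_injective {R : Type*} [CommRing R] (n : ℕ) :
    Function.Injective (dehom (R := R) n) := fun v w h ↦
  funext fun i ↦ by rw [← dehom_coeff v i, h, dehom_coeff w i]

theorem dehom_eq_zero_iff {R : Type*} [CommRing R] {n : ℕ} {w : Fin (n + 1) → R} :
    dehom n w = 0 ↔ w = 0 := by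
  have h0 : dehom n (0 : Fin (n + 1) → R) = 0 := by simp [dehom]
  rw [← h0, (dehom_injective n).eq_iff]

theorem natDegree_dehom_le {R : Type*} [CommRing R] {n : ℕ} (w : Fin (n + 1) → R) :
    (dehom n w).natDegree ≤ n :=
  natDegree_sum_le_of_forall_le _ _ fun i _ ↦
    (natDegree_C_mul_X_pow_le _ _).trans (Nat.le_of_lt_succ i.isLt)

theorem natDegree_dehom_lt {R : Type*} [CommRing R] {n : ℕ} {w : Fin (n + 1) → R}
    (hw : w ≠ 0) (hlast : w (Fin.last n) = 0) : (dehom n w).natDegree < n := by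
  refine (natDegree_dehom_le w).lt_of_ne fun h ↦ hw ?_
  have hc := dehom_coeff w (Fin.last n)
  rw [hlast, Fin.val_last] at hc
  rw [← dehom_eq_zero_iff, ← leadingCoeff_eq_zero, leadingCoeff, h, hc]

section Radical

open scoped Classical

variable {K : Type*} [Field K]

/-- The radical of a polynomial, rescaled to have the same leading coefficient. -/
def scaledRadical (f : K[X]) : K[X] := C f.leadingCoeff * radical f

theorem monic_of_mem_normalizedFactors {f q : K[X]} (hq : q ∈ normalizedFactors f) : q.Monic := by
  have hf : f ≠ 0 := by
    rintro rfl
    simp at hq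
  exact ((Polynomial.mem_normalizedFactors_iff hf).1 hq).2.1

theorem monic_radical (f : K[X]) : (radical f).Monic :=
  monic_prod_of_monic _ _ fun _ hq ↦ monic_of_mem_normalizedFactors (mem_primeFactors.1 hq)

theorem natDegree_radical (f : K[X]) :
    (radical f).natDegree = ∑ q ∈ primeFactors f, q.natDegree :=
  natDegree_prod_of_monic _ _ fun _ hq ↦ monic_of_mem_normalizedFactors (mem_primeFactors.1 hq)

theorem leadingCoeff_scaledRadical (f : K[X]) :
    (scaledRadical f).leadingCoeff = f.leadingCoeff := by
  simp [scaledRadical, (monic_radical f).leadingCoeff]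

theorem natDegree_scaledRadical_le (f : K[X]) :
    (scaledRadical f).natDegree ≤ (radical f).natDegree :=
  natDegree_C_mul_le _ _

theorem primeFactors_scaledRadical (f : K[X]) :
    primeFactors (scaledRadical f) = primeFactors f := by
  rcases eq_or_ne f 0 with rfl | hf
  · simp [scaledRadical]
  · have hu : IsUnit (C f.leadingCoeff) := isUnit_C.2 (leadingCoeff_ne_zero.2 hf).isUnit
    rw [← primeFactors_radical (a := f)]
    exact ((associated_isUnit_mul_left_iff hu).2 (Associated.refl _)).primeFactors_eq

theorem card_normalizedFactors_le_natDegree (f : K[X]) :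
    (normalizedFactors f).card ≤ f.natDegree := by
  rcases eq_or_ne f 0 with rfl | hf
  · simp
  have hdeg : (normalizedFactors f).prod.natDegree = f.natDegree := by
    rw [prod_normalizedFactors_eq hf]
    exact natDegree_eq_of_degree_eq degree_normalize
  rw [← hdeg, natDegree_multiset_prod_of_monic _ fun _ ↦ monic_of_mem_normalizedFactors]
  have h := Multiset.card_nsmul_le_sum (s := (normalizedFactors f).map natDegree) (a := 1) (by
    intro d hd
    obtain ⟨q, hq, rfl⟩ := Multiset.mem_map.1 hd
    exact (irreducible_of_normalized_factor q hq).natDegree_pos)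
  simpa using h

/-- A polynomial is determined by its leading coefficient, its prime factors and their
multiplicities, so the fibres of `scaledRadical` in bounded degree have bounded size. -/
theorem card_filter_scaledRadical_eq_le {n : ℕ} (s : Finset K[X])
    (hs : ∀ f ∈ s, f.natDegree ≤ n) (g : K[X]) :
    (s.filter fun f ↦ scaledRadical f = g).card ≤ (n + 1) ^ n := by
  rcases (s.filter fun f ↦ scaledRadical f = g).eq_empty_or_nonempty with he | ⟨f₀, hf₀⟩
  · simp [he]
  have hcard : (primeFactors g).card ≤ n := by
    obtain ⟨hmem, rfl⟩ := Finset.mem_filter.1 hf₀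
    rw [primeFactors_scaledRadical, ← toFinset_normalizedFactors]
    exact (Multiset.toFinset_card_le _).trans
      ((card_normalizedFactors_le_natDegree f₀).trans (hs f₀ hmem))
  calc (s.filter fun f ↦ scaledRadical f = g).card
      ≤ ((primeFactors g).pi fun _ ↦ Finset.range (n + 1)).card := by
        refine Finset.card_le_card_of_injOn (fun f q _ ↦ (normalizedFactors f).count q) ?_ ?_
        · intro f hf
          have hmem := (Finset.mem_filter.1 hf).1
          refine Finset.mem_pi.2 fun q _ ↦ Finset.mem_range_succ_iff.2 ?_
          exact (Multiset.count_le_card _ _).trans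
            ((card_normalizedFactors_le_natDegree f).trans (hs f hmem))
        · intro f hf f' hf' h
          have hfg := (Finset.mem_filter.1 hf).2
          have hfg' := (Finset.mem_filter.1 hf').2
          have hlead : f.leadingCoeff = f'.leadingCoeff := by
            rw [← leadingCoeff_scaledRadical f, hfg, ← hfg', leadingCoeff_scaledRadical]
          have hfac : normalizedFactors f = normalizedFactors f' := by
            ext q
            by_cases hq : q ∈ primeFactors g
            · exact congrFun (congrFun h q) hq
            · rw [Multiset.count_eq_zero_of_notMem, Multiset.count_eq_zero_of_notMem]
              · rwa [← mem_primeFactors, ← primeFactors_scaledRadical, hfg']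
              · rwa [← mem_primeFactors, ← primeFactors_scaledRadical, hfg]
          rw [← leadingCoeff_mul_prod_normalizedFactors f, hlead, hfac,
            leadingCoeff_mul_prod_normalizedFactors]
    _ = (n + 1) ^ (primeFactors g).card := by simp
    _ ≤ (n + 1) ^ n := Nat.pow_le_pow_right n.succ_pos hcard

theorem natDegree_radical_add_lt {n k : ℕ} {w : Fin (n + 1) → K} (hw : w ≠ 0)
    (hlast : w (Fin.last n) = 0) (hk : k ≤ binIndex n w) :
    (radical (dehom n w)).natDegree + k < n := by
  have hlt := natDegree_dehom_lt hw hlast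
  have hle : (radical (dehom n w)).natDegree ≤ (dehom n w).natDegree :=
    natDegree_le_of_dvd radical_dvd_self (dehom_eq_zero_iff.not.2 hw)
  rw [binIndex, if_pos hlt, toFinset_normalizedFactors, ← natDegree_radical] at hk
  omega

theorem card_le_of_degree_lt [Fintype K] {m : ℕ} (s : Finset K[X])
    (hs : ∀ f ∈ s, f.degree < m) : s.card ≤ Fintype.card K ^ m := by
  calc s.card ≤ (Finset.univ : Finset (Fin m → K)).card := by
        refine Finset.card_le_card_of_injOn (fun f i ↦ f.coeff i) (by simp) ?_
        intro f hf g hg h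
        ext i
        rcases lt_or_ge i m with hi | hi
        · exact congrFun h ⟨i, hi⟩
        · have hmi : (m : WithBot ℕ) ≤ i := by exact_mod_cast hi
          rw [coeff_eq_zero_of_degree_lt ((hs f hf).trans_le hmi),
            coeff_eq_zero_of_degree_lt ((hs g hg).trans_le hmi)]
    _ = Fintype.card K ^ m := by simp

theorem card_binary_forms_high_index_le [Fintype K] (n k : ℕ) :
    Nat.card {w : Fin (n + 1) → K // w (Fin.last n) = 0 ∧ (w = 0 ∨ k ≤ binIndex n w)} ≤
      (n + 1) ^ n * Fintype.card K ^ (n - k) := by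
  rw [Nat.card_eq_fintype_card, Fintype.card_subtype,
    ← Finset.card_image_of_injective _ (dehom_injective n)]
  refine (Finset.card_le_mul_card_image _ ((n + 1) ^ n) fun g _ ↦
    card_filter_scaledRadical_eq_le _ ?_ g).trans
      (Nat.mul_le_mul_left _ (card_le_of_degree_lt _ ?_))
  · intro f hf
    obtain ⟨w, -, rfl⟩ := Finset.mem_image.1 hf
    exact natDegree_dehom_le w
  · intro g hg
    obtain ⟨f, hf, rfl⟩ := Finset.mem_image.1 hg
    obtain ⟨w, hw, rfl⟩ := Finset.mem_image.1 hf
    obtain ⟨hlast, hidx⟩ := (Finset.mem_filter.1 hw).2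
    rcases eq_or_ne w 0 with rfl | hw0
    · simp [scaledRadical, dehom_eq_zero_iff.2 rfl]
    · have hlt := natDegree_radical_add_lt hw0 hlast (hidx.resolve_left hw0)
      have hle := natDegree_scaledRadical_le (dehom n w)
      exact degree_le_natDegree.trans_lt (by exact_mod_cast (by omega :
        (scaledRadical (dehom n w)).natDegree < n - k))

end Radical

/-- **Lemma 4.4**: fix `n` and `k ≥ 0`.  For every prime `p`, the number of degree-`n`
binary forms `g` over `𝔽ₚ` with `y ∣ g` (i.e. `g(1,0) = 0`) and `ind(g) ≥ k` is
`O(p^(n-k))`, with implied constant depending only on `n` (the zero form, of index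
`∞`, being counted as well). -/
theorem count_binary_forms_high_index (n k : ℕ) :
    ∃ c : ℝ, 0 < c ∧ ∀ (p : ℕ), ∀ hp : p.Prime,
      haveI : Fact p.Prime := ⟨hp⟩
      (Nat.card {w : Fin (n + 1) → ZMod p //
          w (Fin.last n) = 0 ∧ (w = 0 ∨ k ≤ binIndex n w)} : ℝ) ≤
        c * (p : ℝ) ^ (n - k) := by
  refine ⟨(n + 1) ^ n, by positivity, fun p hp ↦ ?_⟩
  have : Fact p.Prime := ⟨hp⟩
  have h := card_binary_forms_high_index_le (K := ZMod p) n k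
  rw [ZMod.card] at h
  exact_mod_cast h

end
end
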